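/- Let T be a continuous Archimedean t-norm on [0,1], let u ∈ (0,1], z ∈ [0,1], and p ∈ ℕ₊. If z_T^(p) = u, then u_T^(1/p) = z. -/

import Mathlib

open Set

/-- A t-norm on `[0,1]`: commutative, associative, nondecreasing in each argument,
with neutral element `1`. -/
structure IsTnorm (T : ℝ → ℝ → ℝ) : Prop where
  maps_to : ∀ x ∈ Icc (0:ℝ) 1, ∀ y ∈ Icc (0:ℝ) 1, T x y ∈ Icc (0:ℝ) 1
  comm : ∀ x ∈ Icc (0:ℝ) 1, ∀ y ∈ Icc (0:ℝ) 1, T x y = T y x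
  assoc : ∀ x ∈ Icc (0:ℝ) 1, ∀ y ∈ Icc (0:ℝ) 1, ∀ z ∈ Icc (0:ℝ) 1,
    T (T x y) z = T x (T y z)
  mono : ∀ x ∈ Icc (0:ℝ) 1, ∀ y ∈ Icc (0:ℝ) 1, ∀ z ∈ Icc (0:ℝ) 1,
    y ≤ z → T x y ≤ T x z
  one : ∀ x ∈ Icc (0:ℝ) 1, T x 1 = x

/-- A t-conorm on `[0,1]`: commutative, associative, nondecreasing in each argument,
with neutral element `0`. -/
structure IsTconorm (S : ℝ → ℝ → ℝ) : Prop where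
  maps_to : ∀ x ∈ Icc (0:ℝ) 1, ∀ y ∈ Icc (0:ℝ) 1, S x y ∈ Icc (0:ℝ) 1
  comm : ∀ x ∈ Icc (0:ℝ) 1, ∀ y ∈ Icc (0:ℝ) 1, S x y = S y x
  assoc : ∀ x ∈ Icc (0:ℝ) 1, ∀ y ∈ Icc (0:ℝ) 1, ∀ z ∈ Icc (0:ℝ) 1,
    S (S x y) z = S x (S y z)
  mono : ∀ x ∈ Icc (0:ℝ) 1, ∀ y ∈ Icc (0:ℝ) 1, ∀ z ∈ Icc (0:ℝ) 1,
    y ≤ z → S x y ≤ S x z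
  zero : ∀ x ∈ Icc (0:ℝ) 1, S x 0 = x

/-- Continuity of a binary operation on the unit square. -/
def ContinuousOn2 (T : ℝ → ℝ → ℝ) : Prop :=
  ContinuousOn (fun p : ℝ × ℝ => T p.1 p.2) (Icc (0:ℝ) 1 ×ˢ Icc (0:ℝ) 1)

/-- `n`-fold power `u_T^(n)` with respect to a t-norm: `u_T^(0) = 1`,
`u_T^(n+1) = T (u_T^(n)) u`. -/
def Tpow (T : ℝ → ℝ → ℝ) (u : ℝ) : ℕ → ℝ
  | 0 => 1
  | n + 1 => T (Tpow T u n) u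

/-- `n`-fold power `u_S^(n)` with respect to a t-conorm: `u_S^(0) = 0`,
`u_S^(n+1) = S (u_S^(n)) u`. -/
def Spow (S : ℝ → ℝ → ℝ) (u : ℝ) : ℕ → ℝ
  | 0 => 0
  | n + 1 => S (Spow S u n) u

/-- `p`-th root `u_T^(1/p) = sup {v ∈ [0,1] | v_T^(p) < u}`. -/
noncomputable def Troot (T : ℝ → ℝ → ℝ) (u : ℝ) (p : ℕ) : ℝ :=
  sSup {v ∈ Icc (0:ℝ) 1 | Tpow T v p < u}

/-- `p`-th root `u_S^(1/p) = inf {v ∈ [0,1] | v_S^(p) > u}`. -/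
noncomputable def Sroot (S : ℝ → ℝ → ℝ) (u : ℝ) (p : ℕ) : ℝ :=
  sInf {v ∈ Icc (0:ℝ) 1 | u < Spow S v p}

/-- Rational power `u_T^(q/p) = (u_T^(1/p))_T^(q)`, with `r = q/p` in lowest terms. -/
noncomputable def TratPow (T : ℝ → ℝ → ℝ) (u : ℝ) (r : ℚ) : ℝ :=
  Tpow T (Troot T u r.den) r.num.toNat

/-- Rational power `u_S^(q/p) = (u_S^(1/p))_S^(q)`, with `r = q/p` in lowest terms. -/
noncomputable def SratPow (S : ℝ → ℝ → ℝ) (u : ℝ) (r : ℚ) : ℝ :=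
  Spow S (Sroot S u r.den) r.num.toNat

/-- Real power `u_T^(t) = inf {u_T^(r) | r ∈ [0,t] ∩ ℚ}`. -/
noncomputable def TrePow (T : ℝ → ℝ → ℝ) (u : ℝ) (t : ℝ) : ℝ :=
  sInf (TratPow T u '' {r : ℚ | 0 ≤ r ∧ (r : ℝ) ≤ t})

/-- Real power `u_S^(t) = sup {u_S^(r) | r ∈ [0,t] ∩ ℚ}`. -/
noncomputable def SrePow (S : ℝ → ℝ → ℝ) (u : ℝ) (t : ℝ) : ℝ :=
  sSup (SratPow S u '' {r : ℚ | 0 ≤ r ∧ (r : ℝ) ≤ t})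

/-- A t-norm is Archimedean if for all `x, y ∈ (0,1)` there is `n` with `x_T^(n) < y`. -/
def TnormArchimedean (T : ℝ → ℝ → ℝ) : Prop :=
  ∀ x ∈ Ioo (0:ℝ) 1, ∀ y ∈ Ioo (0:ℝ) 1, ∃ n : ℕ, Tpow T x n < y

/-- Strict monotonicity of a t-norm: `T x y < T x z` whenever `x > 0` and `y < z`. -/
def TnormStrictMono (T : ℝ → ℝ → ℝ) : Prop :=
  ∀ x ∈ Icc (0:ℝ) 1, 0 < x → ∀ y ∈ Icc (0:ℝ) 1, ∀ z ∈ Icc (0:ℝ) 1, y < z → T x y < T x z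

/-- Pseudo-inverse of a decreasing `G : [0,1] → [0,∞]`:
`G^(−1)(y) = sup {x ∈ [0,1] | G x > y}`. -/
noncomputable def pseudoInv (G : ℝ → ENNReal) (y : ENNReal) : ℝ :=
  sSup {x ∈ Icc (0:ℝ) 1 | y < G x}

/-- `G : [0,1] → [0,∞]` is an additive generator of the t-norm `T`. -/
structure IsAddGen (T : ℝ → ℝ → ℝ) (G : ℝ → ENNReal) : Prop where
  strictAnti : StrictAntiOn G (Icc (0:ℝ) 1)
  rightContinuousAtZero : ContinuousWithinAt G (Icc (0:ℝ) 1) 0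
  map_one : G 1 = 0
  sum_mem : ∀ x ∈ Icc (0:ℝ) 1, ∀ y ∈ Icc (0:ℝ) 1,
    G x + G y ∈ G '' Icc (0:ℝ) 1 ∪ Icc (G 0) ⊤
  eq_pseudoInv : ∀ x ∈ Icc (0:ℝ) 1, ∀ y ∈ Icc (0:ℝ) 1, T x y = pseudoInv G (G x + G y)

namespace IsTnorm

variable {T : ℝ → ℝ → ℝ}

theorem mono_left (hT : IsTnorm T) {x y z : ℝ} (hx : x ∈ Icc (0:ℝ) 1) (hy : y ∈ Icc (0:ℝ) 1)
    (hz : z ∈ Icc (0:ℝ) 1) (h : x ≤ y) : T x z ≤ T y z := by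
  rw [hT.comm x hx z hz, hT.comm y hy z hz]
  exact hT.mono z hz x hx y hy h

theorem le_right (hT : IsTnorm T) {x y : ℝ} (hx : x ∈ Icc (0:ℝ) 1) (hy : y ∈ Icc (0:ℝ) 1) :
    T x y ≤ y := by
  have h1 : (1:ℝ) ∈ Icc (0:ℝ) 1 := right_mem_Icc.2 zero_le_one
  calc T x y ≤ T 1 y := hT.mono_left hx h1 hy hx.2
    _ = y := by rw [hT.comm 1 h1 y hy, hT.one y hy]

theorem apply_zero (hT : IsTnorm T) {x : ℝ} (hx : x ∈ Icc (0:ℝ) 1) : T x 0 = 0 := by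
  have h0 : (0:ℝ) ∈ Icc (0:ℝ) 1 := left_mem_Icc.2 zero_le_one
  exact le_antisymm (hT.le_right hx h0) (hT.maps_to x hx 0 h0).1

theorem tpow_mem (hT : IsTnorm T) {u : ℝ} (hu : u ∈ Icc (0:ℝ) 1) (n : ℕ) :
    Tpow T u n ∈ Icc (0:ℝ) 1 := by
  induction n with
  | zero => exact right_mem_Icc.2 zero_le_one
  | succ n ih => exact hT.maps_to _ ih _ hu

theorem tpow_mono (hT : IsTnorm T) {u v : ℝ} (hu : u ∈ Icc (0:ℝ) 1) (hv : v ∈ Icc (0:ℝ) 1)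
    (h : u ≤ v) (n : ℕ) : Tpow T u n ≤ Tpow T v n := by
  induction n with
  | zero => exact le_rfl
  | succ n ih =>
    exact (hT.mono_left (hT.tpow_mem hu n) (hT.tpow_mem hv n) hu ih).trans
      (hT.mono _ (hT.tpow_mem hv n) u hu v hv h)

theorem exists_apply_eq (hT : IsTnorm T) (hTc : ContinuousOn2 T) {v z : ℝ}
    (hz : z ∈ Icc (0:ℝ) 1) (hv : v ∈ Icc (0:ℝ) z) : ∃ w ∈ Icc (0:ℝ) 1, T z w = v := by
  have hc : ContinuousOn (fun w => T z w) (Icc (0:ℝ) 1) :=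
    hTc.comp (f := fun w : ℝ => (z, w)) (by fun_prop) fun w hw => ⟨hz, hw⟩
  refine intermediate_value_Icc zero_le_one hc ?_
  simpa only [hT.apply_zero hz, hT.one z hz] using hv

theorem apply_lt_left (hT : IsTnorm T) (hA : TnormArchimedean T) {u w : ℝ}
    (hu : u ∈ Ioc (0:ℝ) 1) (hw : w ∈ Ico (0:ℝ) 1) : T u w < u := by
  have hu' : u ∈ Icc (0:ℝ) 1 := Ioc_subset_Icc_self hu
  have hw' : w ∈ Icc (0:ℝ) 1 := Ico_subset_Icc_self hw
  by_contra! h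
  have hle (n : ℕ) : u ≤ Tpow T w n := by
    induction n with
    | zero => exact hu.2
    | succ n ih => exact h.trans (hT.mono_left hu' (hT.tpow_mem hw' n) hw' ih)
  rcases hw.1.eq_or_lt with rfl | hw0
  · rw [hT.apply_zero hu'] at h
    exact h.not_gt hu.1
  · obtain ⟨n, hn⟩ := hA w ⟨hw0, hw.2⟩ (u / 2) ⟨by linarith [hu.1], by linarith [hu.2]⟩
    linarith [hle n, hu.1]

theorem tpow_lt_tpow (hT : IsTnorm T) (hTc : ContinuousOn2 T) (hA : TnormArchimedean T)
    {v z : ℝ} (hv : v ∈ Icc (0:ℝ) 1) (hz : z ∈ Icc (0:ℝ) 1) (hvz : v < z) {p : ℕ} (hp : 0 < p)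
    (hpos : 0 < Tpow T z p) : Tpow T v p < Tpow T z p := by
  obtain ⟨w, hw, rfl⟩ := hT.exists_apply_eq hTc hz ⟨hv.1, hvz.le⟩
  have hw1 : w < 1 := by
    refine hw.2.lt_of_ne ?_
    rintro rfl
    exact hvz.ne (hT.one z hz)
  obtain ⟨n, rfl⟩ := Nat.exists_eq_add_one.2 hp
  calc Tpow T (T z w) (n + 1) ≤ T (Tpow T z n) (T z w) :=
        hT.mono_left (hT.tpow_mem hv n) (hT.tpow_mem hz n) hv (hT.tpow_mono hv hz hvz.le n)
    _ = T (Tpow T z (n + 1)) w := (hT.assoc _ (hT.tpow_mem hz n) z hz w hw).symm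
    _ < Tpow T z (n + 1) :=
        hT.apply_lt_left hA ⟨hpos, (hT.tpow_mem hz (n + 1)).2⟩ ⟨hw.1, hw1⟩

end IsTnorm

/-- For a continuous Archimedean t-norm `T`, if `z_T^(p) = u` with
`u ∈ (0,1]`, then `u_T^(1/p) = z`. -/
theorem root_of_pow (T : ℝ → ℝ → ℝ) (hT : IsTnorm T) (hTc : ContinuousOn2 T)
    (hA : TnormArchimedean T) (u z : ℝ) (hu : u ∈ Ioc (0:ℝ) 1) (hz : z ∈ Icc (0:ℝ) 1)
    (p : ℕ) (hp : 0 < p) (h : Tpow T z p = u) :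
    Troot T u p = z := by
  subst h
  have hset : {v ∈ Icc (0:ℝ) 1 | Tpow T v p < Tpow T z p} = Ico 0 z := by
    ext v
    constructor
    · rintro ⟨hv, hlt⟩
      exact ⟨hv.1, lt_of_not_ge fun hzv => hlt.not_ge (hT.tpow_mono hz hv hzv p)⟩
    · rintro ⟨hv0, hvz⟩
      have hv : v ∈ Icc (0:ℝ) 1 := ⟨hv0, hvz.le.trans hz.2⟩
      exact ⟨hv, hT.tpow_lt_tpow hTc hA hv hz hvz hp hu.1⟩
  have hz0 : 0 < z := by
    refine hz.1.lt_of_ne ?_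
    rintro rfl
    obtain ⟨n, rfl⟩ := Nat.exists_eq_add_one.2 hp
    exact hu.1.ne' (hT.apply_zero (hT.tpow_mem hz n))
  rw [Troot, hset, csSup_Ico hz0]
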